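/- (Candidate reduction) If removing a single edge {u,v} from a finite simple graph G strictly decreases the core value of some vertex i, i.e., C(i, G−{u,v}) < C(i,G), then min(C(u,G), C(v,G)) = C(i,G). -/

import Mathlib

/-- A set `S` of vertices is `k`-supported in `G` if every vertex of `S`
has at least `k` neighbors inside `S`. -/
def kSupported {V : Type*} (G : SimpleGraph V) (k : ℕ) (S : Set V) : Prop :=
  ∀ i ∈ S, k ≤ {j | j ∈ S ∧ G.Adj i j}.ncard

/-- The `k`-core of `G`: the union of all `k`-supported sets. -/
def kCore {V : Type*} (G : SimpleGraph V) (k : ℕ) : Set V :=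
  ⋃₀ {S | kSupported G k S}

/-- The core value `C(i,G)` of a vertex `i`: the largest `k` with `i ∈ V_k(G)`. -/
noncomputable def coreValue {V : Type*} (G : SimpleGraph V) (i : V) : ℕ :=
  sSup {k | i ∈ kCore G k}

/-- The supportive neighbors of `i` at level `k`:
neighbors `j` of `i` with core value at least `k`. -/
def SN {V : Type*} (G : SimpleGraph V) (i : V) (k : ℕ) : Set V :=
  {j | G.Adj i j ∧ k ≤ coreValue G j}

/-- `SN(i,G)`: abbreviation for `SN(i, C(i,G), G)`. -/
noncomputable def SNc {V : Type*} (G : SimpleGraph V) (i : V) : Set V :=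
  SN G i (coreValue G i)

/-- The core strength `CS(i,G) = |SN(i,G)| - C(i,G) + 1`. -/
noncomputable def CS {V : Type*} (G : SimpleGraph V) (i : V) : ℕ :=
  (SNc G i).ncard - coreValue G i + 1

theorem kSupported.mono {V : Type*} {G : SimpleGraph V} {k l : ℕ} {S : Set V} (hkl : k ≤ l)
    (h : kSupported G l S) : kSupported G k S :=
  fun i hi => hkl.trans (h i hi)

theorem kCore_anti {V : Type*} (G : SimpleGraph V) {k l : ℕ} (hkl : k ≤ l) :
    kCore G l ⊆ kCore G k :=
  Set.sUnion_subset_sUnion fun _ hS => kSupported.mono hkl hS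

theorem kSupported_kCore {V : Type*} [Finite V] (G : SimpleGraph V) (k : ℕ) :
    kSupported G k (kCore G k) := by
  rintro i ⟨S, hS, hi⟩
  refine (hS i hi).trans (Set.ncard_le_ncard ?_ (Set.toFinite _))
  exact fun j hj => ⟨⟨S, hS, hj.1⟩, hj.2⟩

theorem mem_kCore_iff {V : Type*} [Finite V] (G : SimpleGraph V) (k : ℕ) (i : V) :
    i ∈ kCore G k ↔ k ≤ coreValue G i := by
  have hb : BddAbove {k | i ∈ kCore G k} := by
    refine ⟨Nat.card V, fun l hl => ?_⟩
    exact (kSupported_kCore G l i hl).trans (Set.ncard_le_card _)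
  have hne : {k | i ∈ kCore G k}.Nonempty :=
    ⟨0, Set.univ, fun _ _ => Nat.zero_le _, Set.mem_univ i⟩
  exact ⟨fun h => le_csSup hb h, fun h => kCore_anti G h (Nat.sSup_mem hne hb)⟩

/-- Deleting the edge `{u, v}` preserves a `k`-supported set, provided that, if the edge lies
inside the set, both of its endpoints have a neighbor to spare. -/
theorem kSupported.deleteEdges {V : Type*} [Finite V] {G : SimpleGraph V} {k : ℕ} {S : Set V}
    {u v : V} (hS : kSupported G k S)
    (h : u ∈ S → v ∈ S → ∀ x, x = u ∨ x = v → k + 1 ≤ {j | j ∈ S ∧ G.Adj x j}.ncard) :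
    kSupported (G.deleteEdges {s(u, v)}) k S := by
  intro x hx
  by_cases hxe : (x = u ∧ v ∈ S) ∨ (x = v ∧ u ∈ S)
  · obtain ⟨y, hy⟩ : ∃ y, s(u, v) = s(x, y) := by
      rcases hxe with ⟨rfl, -⟩ | ⟨rfl, -⟩
      exacts [⟨v, rfl⟩, ⟨u, Sym2.eq_swap⟩]
    have hsub : {j | j ∈ S ∧ G.Adj x j} \ {y} ⊆
        {j | j ∈ S ∧ (G.deleteEdges {s(u, v)}).Adj x j} := by
      rintro j ⟨⟨hj, hadj⟩, hne⟩
      refine ⟨hj, SimpleGraph.deleteEdges_adj.2 ⟨hadj, fun hmem => hne ?_⟩⟩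
      exact Sym2.congr_right.1 (hmem.trans hy)
    have hcard : k + 1 ≤ {j | j ∈ S ∧ G.Adj x j}.ncard := by
      rcases hxe with ⟨rfl, hv⟩ | ⟨rfl, hu⟩
      exacts [h hx hv x (Or.inl rfl), h hu hx x (Or.inr rfl)]
    have hle := Set.ncard_le_ncard hsub (Set.toFinite _)
    have hdiff := Set.pred_ncard_le_ncard_sdiff_singleton {j | j ∈ S ∧ G.Adj x j} y
    omega
  · refine (hS x hx).trans (Set.ncard_le_ncard ?_ (Set.toFinite _))
    rintro j ⟨hj, hadj⟩
    refine ⟨hj, SimpleGraph.deleteEdges_adj.2 ⟨hadj, fun hmem => hxe ?_⟩⟩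
    rcases Sym2.eq_iff.1 hmem with ⟨rfl, rfl⟩ | ⟨rfl, rfl⟩
    exacts [Or.inl ⟨rfl, hj⟩, Or.inr ⟨rfl, hj⟩]

theorem stmt_8 {V : Type*} [Fintype V] (G : SimpleGraph V) (u v i : V)
    (huv : G.Adj u v)
    (hdrop : coreValue (G.deleteEdges {s(u, v)}) i < coreValue G i) :
    min (coreValue G u) (coreValue G v) = coreValue G i := by
  by_contra hne
  have hsupp : kSupported (G.deleteEdges {s(u, v)}) (coreValue G i) (kCore G (coreValue G i)) := by
    refine (kSupported_kCore G _).deleteEdges fun hu hv x hx => ?_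
    rw [mem_kCore_iff] at hu hv
    have hxk : x ∈ kCore G (coreValue G i + 1) := by
      rw [mem_kCore_iff]
      rcases hx with rfl | rfl <;> omega
    refine (kSupported_kCore G _ x hxk).trans (Set.ncard_le_ncard ?_ (Set.toFinite _))
    exact fun j hj => ⟨kCore_anti G (Nat.le_succ _) hj.1, hj.2⟩
  refine hdrop.not_ge ((mem_kCore_iff _ _ _).1 ⟨_, hsupp, ?_⟩)
  exact (mem_kCore_iff _ _ _).2 le_rfl
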